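/- Let f ∈ ℂ[X] with deg f > 1. Then f is cyclic if and only if f has a unique finite branch point, which holds if and only if f has a unique finite ramification point. Likewise, f is dihedral if and only if f has precisely two finite branch points and every finite ramification point of f has ramification index 2; moreover these conditions imply that f has precisely two special points. -/

import Mathlib

open Polynomial

/-- The normalized degree-`n` Chebyshev polynomial `T_n`, characterized by
`T_n(Y + 1/Y) = Y^n + 1/Y^n`; it is the Dickson polynomial `D_n(X, 1)`
of the first kind. -/
noncomputable def chebT (n : ℕ) : ℂ[X] :=
  Polynomial.dickson 1 (1 : ℂ) n

/-- The ramification index `e_f(x₀)`: the multiplicity of `x₀` as a root of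
`f(X) - f(x₀)`. -/
noncomputable def ramIndex (f : ℂ[X]) (x₀ : ℂ) : ℕ :=
  Polynomial.rootMultiplicity x₀ (f - Polynomial.C (f.eval x₀))

/-- `x₀` is a finite ramification point of `f`. -/
def IsRamPt (f : ℂ[X]) (x₀ : ℂ) : Prop :=
  1 < ramIndex f x₀

/-- `y` is a finite branch point of `f`. -/
def IsBranchPt (f : ℂ[X]) (y : ℂ) : Prop :=
  ∃ x₀ : ℂ, IsRamPt f x₀ ∧ f.eval x₀ = y

/-- `x₀` is a special point of `f`: it is unramified but its image is a finite
branch point. -/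
def IsSpecialPt (f : ℂ[X]) (x₀ : ℂ) : Prop :=
  ramIndex f x₀ = 1 ∧ IsBranchPt f (f.eval x₀)

/-- `f` is cyclic: equivalent (by composing with linears) to `X^n` for some `n > 1`. -/
def CyclicPoly (f : ℂ[X]) : Prop :=
  ∃ n : ℕ, 1 < n ∧ ∃ ℓ₁ ℓ₂ : ℂ[X], ℓ₁.natDegree = 1 ∧ ℓ₂.natDegree = 1 ∧
    f = ℓ₁.comp ((Polynomial.X ^ n).comp ℓ₂)

/-- `f` is dihedral: equivalent (by composing with linears) to `T_n` for some `n > 2`. -/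
def DihedralPoly (f : ℂ[X]) : Prop :=
  ∃ n : ℕ, 2 < n ∧ ∃ ℓ₁ ℓ₂ : ℂ[X], ℓ₁.natDegree = 1 ∧ ℓ₂.natDegree = 1 ∧
    f = ℓ₁.comp ((chebT n).comp ℓ₂)

/-- The ramification index exceeds by one the multiplicity of the point as a zero of the
derivative. -/
lemma ramIndex_eq_rootMultiplicity_derivative_add_one {f : ℂ[X]} (hf : 0 < f.natDegree) (x : ℂ) :
    ramIndex f x = f.derivative.rootMultiplicity x + 1 := by
  have hne : f - C (f.eval x) ≠ 0 := by
    intro h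
    rw [sub_eq_zero.mp h, natDegree_C] at hf
    exact hf.false
  have hroot : (f - C (f.eval x)).IsRoot x := by simp
  have hpos := (rootMultiplicity_pos hne).mpr hroot
  have hder := derivative_rootMultiplicity_of_root hroot
  simp only [derivative_sub, derivative_C, sub_zero] at hder
  unfold ramIndex
  omega

lemma derivative_ne_zero_of_natDegree_pos {f : ℂ[X]} (hf : 0 < f.natDegree) :
    f.derivative ≠ 0 := fun h => hf.ne' (derivative_eq_zero.mp h)

lemma isRamPt_iff_eval_derivative_eq_zero {f : ℂ[X]} (hf : 0 < f.natDegree) (x : ℂ) :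
    IsRamPt f x ↔ f.derivative.eval x = 0 := by
  have h := rootMultiplicity_pos (x := x) (derivative_ne_zero_of_natDegree_pos hf)
  rw [IsRamPt, ramIndex_eq_rootMultiplicity_derivative_add_one hf, ← IsRoot.def, ← h]
  omega

lemma ramIndex_eq_one_iff {f : ℂ[X]} (hf : 0 < f.natDegree) (x : ℂ) :
    ramIndex f x = 1 ↔ f.derivative.eval x ≠ 0 := by
  rw [← not_iff_not, not_not, ← isRamPt_iff_eval_derivative_eq_zero hf, IsRamPt]
  have := ramIndex_eq_rootMultiplicity_derivative_add_one hf x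
  omega

lemma ramIndex_eq_two_of_eval_derivative {f : ℂ[X]} (hf : 0 < f.natDegree) {x : ℂ}
    (h₁ : f.derivative.eval x = 0) (h₂ : f.derivative.derivative.eval x ≠ 0) :
    ramIndex f x = 2 := by
  have hne := derivative_ne_zero_of_natDegree_pos hf
  have hpos := (rootMultiplicity_pos hne).mpr h₁
  have hlt : ¬ 1 < f.derivative.rootMultiplicity x := fun h =>
    h₂ ((one_lt_rootMultiplicity_iff_isRoot hne).mp h).2
  rw [ramIndex_eq_rootMultiplicity_derivative_add_one hf]
  omega

/-- A polynomial all of whose critical values equal `y` is a power of a linear polynomial up to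
affine transformation. -/
lemma eq_C_add_C_mul_X_sub_C_pow_of_critical_values {f : ℂ[X]} (hf : 1 < f.natDegree) {y : ℂ}
    (hy : ∀ x, f.derivative.eval x = 0 → f.eval x = y) :
    ∃ c s : ℂ, c ≠ 0 ∧ f = C y + C c * (X - C s) ^ f.natDegree := by
  have hf0 : 0 < f.natDegree := by omega
  have hder := derivative_ne_zero_of_natDegree_pos hf0
  have hdeg : (f - C y).natDegree = f.natDegree := natDegree_sub_C
  have hne : f - C y ≠ 0 := by
    rintro h
    rw [h, natDegree_zero] at hdeg
    omega
  have hmult : ∀ x, f.derivative.eval x = 0 →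
      (f - C y).rootMultiplicity x = f.derivative.rootMultiplicity x + 1 := by
    intro x hx
    rw [← ramIndex_eq_rootMultiplicity_derivative_add_one hf0, ramIndex, hy x hx]
  have hdvd : f.derivative ∣ f - C y := by
    rw [IsAlgClosed.dvd_iff_roots_le_roots hder hne, Multiset.le_iff_count]
    intro x
    rw [count_roots, count_roots]
    by_cases hx : f.derivative.eval x = 0
    · rw [hmult x hx]
      omega
    · rw [rootMultiplicity_eq_zero hx]
      omega
  obtain ⟨q, hq⟩ := hdvd
  have hq0 : q ≠ 0 := by
    rintro rfl
    exact hne (by simpa using hq)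
  have hqdeg : q.natDegree = 1 := by
    have h := congrArg natDegree hq
    rw [natDegree_mul hder hq0, hdeg, natDegree_derivative] at h
    omega
  obtain ⟨s, hs⟩ : ∃ s, q.roots = {s} := by
    rw [← Multiset.card_eq_one, ← hqdeg]
    exact (IsAlgClosed.splits q).natDegree_eq_card_roots.symm
  have hqroot : ∀ x, q.rootMultiplicity x ≠ 0 → x = s := by
    intro x hx
    rw [← count_roots, hs] at hx
    simpa using Multiset.count_ne_zero.mp hx
  have hroots : f.derivative.roots = Multiset.replicate (f.natDegree - 1) s := by
    rw [Multiset.eq_replicate, ← natDegree_derivative]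
    refine ⟨(IsAlgClosed.splits _).natDegree_eq_card_roots.symm, fun x hx => hqroot x ?_⟩
    have h := hmult x (isRoot_of_mem_roots hx)
    rw [hq, rootMultiplicity_mul (hq ▸ hne)] at h
    omega
  have hdereq := (IsAlgClosed.splits f.derivative).eq_prod_roots
  have hqeq := (IsAlgClosed.splits q).eq_prod_roots
  rw [hroots, Multiset.map_replicate, Multiset.prod_replicate] at hdereq
  rw [hs, Multiset.map_singleton, Multiset.prod_singleton] at hqeq
  refine ⟨f.derivative.leadingCoeff * q.leadingCoeff, s,
    mul_ne_zero (leadingCoeff_ne_zero.mpr hder) (leadingCoeff_ne_zero.mpr hq0), ?_⟩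
  have hpow : (X - C s) ^ f.natDegree = (X - C s) ^ (f.natDegree - 1) * (X - C s) := by
    rw [← pow_succ, Nat.sub_add_cancel hf0]
  rw [← sub_eq_iff_eq_add', hpow, C_mul]
  calc f - C y = f.derivative * q := hq
    _ = (C f.derivative.leadingCoeff * (X - C s) ^ (f.natDegree - 1)) *
        (C q.leadingCoeff * (X - C s)) := by rw [← hdereq, ← hqeq]
    _ = _ := by ring

lemma exists_coeffs_of_natDegree_eq_one {l : ℂ[X]} (hl : l.natDegree = 1) :
    ∃ a b : ℂ, a ≠ 0 ∧ l = C a * X + C b := by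
  obtain ⟨a, ha, b, h⟩ := natDegree_eq_one.mp hl
  exact ⟨a, b, ha, h.symm⟩

lemma existsUnique_isRamPt_of_cyclicPoly {f : ℂ[X]} (hf : 1 < f.natDegree) (h : CyclicPoly f) :
    ∃! x, IsRamPt f x := by
  obtain ⟨n, hn, l₁, l₂, h₁, h₂, hfe⟩ := h
  obtain ⟨a, b, ha, rfl⟩ := exists_coeffs_of_natDegree_eq_one h₁
  obtain ⟨c, d, hc, rfl⟩ := exists_coeffs_of_natDegree_eq_one h₂
  have key : ∀ x, IsRamPt f x ↔ x = -d / c := by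
    intro x
    rw [isRamPt_iff_eval_derivative_eq_zero (by omega), hfe, eq_div_iff hc]
    have hn0 : (n : ℂ) ≠ 0 := by exact_mod_cast (by omega : n ≠ 0)
    have hn1 : n - 1 ≠ 0 := by omega
    simp [derivative_pow, ha, hc, hn0, hn1]
    rw [← eq_neg_iff_add_eq_zero, mul_comm]
  exact ⟨-d / c, (key _).mpr rfl, fun x hx => (key x).mp hx⟩

lemma existsUnique_isBranchPt_of_existsUnique_isRamPt {f : ℂ[X]} (h : ∃! x, IsRamPt f x) :
    ∃! y, IsBranchPt f y := by
  obtain ⟨x, hx, hu⟩ := h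
  refine ⟨f.eval x, ⟨x, hx, rfl⟩, ?_⟩
  rintro _ ⟨z, hz, rfl⟩
  rw [hu z hz]

lemma cyclicPoly_of_existsUnique_isBranchPt {f : ℂ[X]} (hf : 1 < f.natDegree)
    (h : ∃! y, IsBranchPt f y) : CyclicPoly f := by
  obtain ⟨y, -, hu⟩ := h
  obtain ⟨c, s, hc, hfe⟩ := eq_C_add_C_mul_X_sub_C_pow_of_critical_values hf (y := y)
    fun x hx => hu _ ⟨x, (isRamPt_iff_eval_derivative_eq_zero (by omega) x).mpr hx, rfl⟩
  refine ⟨f.natDegree, hf, C c * X + C y, X - C s, natDegree_linear hc, natDegree_X_sub_C s, ?_⟩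
  conv_lhs => rw [hfe]
  simp [add_comm]

section Chebyshev

lemma chebT_add_two (n : ℕ) : chebT (n + 2) = X * chebT (n + 1) - chebT n := by
  simp [chebT, dickson_add_two]

lemma X_sq_sub_four_mul_derivative_chebT (n : ℕ) :
    (X ^ 2 - 4) * derivative (chebT n) = (n : ℂ[X]) * (2 * chebT (n + 1) - X * chebT n) := by
  induction n using Nat.twoStepInduction with
  | zero => norm_num [chebT]
  | one => norm_num [chebT]; ring
  | more n ih₀ ih₁ =>
    have h := congrArg derivative (chebT_add_two n)
    simp only [derivative_sub, derivative_mul, derivative_X] at h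
    rw [h]
    have e := chebT_add_two (n + 1)
    rw [add_right_comm, add_assoc, one_add_one_eq_two] at ih₁
    push_cast at ih₁ ⊢
    rw [e]
    rw [chebT_add_two n] at ih₁ ⊢
    linear_combination X * ih₁ - ih₀

lemma chebT_sq_add_chebT_succ_sq (n : ℕ) :
    chebT n ^ 2 + chebT (n + 1) ^ 2 - X * chebT n * chebT (n + 1) = 4 - X ^ 2 := by
  induction n with
  | zero => norm_num [chebT]; ring
  | succ n ih =>
    rw [chebT_add_two]
    linear_combination ih

lemma X_sq_sub_four_ne_zero : (X ^ 2 - 4 : ℂ[X]) ≠ 0 := by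
  intro h
  simpa using congrArg (eval 0) h

lemma sq_mul_chebT_sq_sub_four (n : ℕ) :
    (n : ℂ[X]) ^ 2 * (chebT n ^ 2 - 4) = (X ^ 2 - 4) * derivative (chebT n) ^ 2 := by
  apply mul_left_cancel₀ X_sq_sub_four_ne_zero
  linear_combination (-1 : ℂ[X]) * ((X ^ 2 - 4) * derivative (chebT n) +
    (n : ℂ[X]) * (2 * chebT (n + 1) - X * chebT n)) * X_sq_sub_four_mul_derivative_chebT n
    - 4 * (n : ℂ[X]) ^ 2 * chebT_sq_add_chebT_succ_sq n

lemma natDegree_chebT (n : ℕ) : (chebT n).natDegree = n := by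
  have h : (C (⅟2 : ℂ) * X).natDegree = 1 := natDegree_C_mul_X _ (by simp)
  rw [chebT, dickson_one_one_eq_chebyshev_T, ← C_ofNat, natDegree_C_mul two_ne_zero, natDegree_comp,
    h, Chebyshev.natDegree_T]
  simp

end Chebyshev

/-- Differentiating the first order equation `k (f - y₁) (f - y₂) = q f'²` gives a linear
equation of second order. -/
lemma second_order_of_first_order {f q : ℂ[X]} {k y₁ y₂ : ℂ} (hf : f.derivative ≠ 0)
    (h : C k * ((f - C y₁) * (f - C y₂)) = q * f.derivative ^ 2) :
    C k * (2 * f - C y₁ - C y₂) = q.derivative * f.derivative + 2 * q * f.derivative.derivative := by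
  have hd := congrArg derivative h
  simp only [derivative_mul, derivative_sub, derivative_C, derivative_pow] at hd
  apply mul_right_cancel₀ hf
  simp only [Nat.cast_ofNat, map_ofNat, zero_mul, zero_add, sub_zero, Nat.add_one_sub_one,
    pow_one] at hd
  linear_combination hd

/-- A polynomial solution of the Chebyshev equation with parameter `n` is determined by its
coefficient of degree `n`. -/
lemma eq_zero_of_chebyshev_equation {w : ℂ[X]} {n : ℕ} (hn : w.coeff n = 0)
    (h : (n : ℂ[X]) ^ 2 * w = X * w.derivative + (X ^ 2 - 4) * w.derivative.derivative) :
    w = 0 := by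
  by_contra hw
  obtain ⟨m, hm⟩ : ∃ m, m = w.natDegree := ⟨_, rfl⟩
  have hlead : w.coeff m ≠ 0 := by
    rw [hm]
    exact leadingCoeff_ne_zero.mpr hw
  have hc1 : w.coeff (m + 1) = 0 := coeff_eq_zero_of_natDegree_lt (by omega)
  have hc2 : w.coeff (m + 2) = 0 := coeff_eq_zero_of_natDegree_lt (by omega)
  have hcoef := congrArg (fun p : ℂ[X] => p.coeff m) h
  have hpow : (n : ℂ[X]) ^ 2 = C ((n : ℂ) ^ 2) := by simp
  have hmn : (m : ℂ) ^ 2 * w.coeff m = (n : ℂ) ^ 2 * w.coeff m := by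
    have h4 : (4 : ℂ[X]) = C 4 := (map_ofNat C 4).symm
    simp only [hpow, h4, coeff_C_mul, coeff_add, sub_mul, coeff_sub] at hcoef
    rcases m with _ | _ | m
    · simp [coeff_derivative, hc1, hc2, pow_two, mul_assoc] at hcoef ⊢
      simpa using hcoef
    · simp [coeff_derivative, hc1, hc2, pow_two, mul_assoc, coeff_X_mul] at hcoef ⊢
      simpa using hcoef.symm
    · simp [coeff_derivative, hc2, pow_two, mul_assoc, coeff_X_mul] at hcoef ⊢
      linear_combination -hcoef
  have hsq : (m : ℂ) ^ 2 = (n : ℂ) ^ 2 := mul_right_cancel₀ hlead hmn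
  have : m = n := by
    have : m ^ 2 = n ^ 2 := by exact_mod_cast hsq
    exact Nat.pow_left_injective two_ne_zero this
  exact hlead (this ▸ hn)

lemma chebyshev_equation_of_first_order {f : ℂ[X]} {n : ℕ} {y₁ y₂ : ℂ} (hf : f.derivative ≠ 0)
    (h : C ((n : ℂ) ^ 2) * ((f - C y₁) * (f - C y₂)) = (X ^ 2 - 4) * f.derivative ^ 2) :
    (n : ℂ[X]) ^ 2 * (f - C ((y₁ + y₂) / 2)) =
      X * f.derivative + (X ^ 2 - 4) * f.derivative.derivative := by
  have h2 := second_order_of_first_order hf h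
  have hC : (2 : ℂ[X]) * C ((y₁ + y₂) / 2) = C y₁ + C y₂ := by
    rw [← C_ofNat, ← C_mul, ← C_add]
    congr 1
    ring
  apply mul_left_cancel₀ (two_ne_zero : (2 : ℂ[X]) ≠ 0)
  simp at h2
  linear_combination h2 - (n : ℂ[X]) ^ 2 * hC

lemma chebT_equation {n : ℕ} (hn : 0 < n) :
    (n : ℂ[X]) ^ 2 * chebT n =
      X * derivative (chebT n) + (X ^ 2 - 4) * derivative (derivative (chebT n)) := by
  have h := chebyshev_equation_of_first_order (f := chebT n) (n := n) (y₁ := 2) (y₂ := -2)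
    (derivative_ne_zero_of_natDegree_pos (by rwa [natDegree_chebT])) (by
      rw [← sq_mul_chebT_sq_sub_four]
      rw [C_neg, map_ofNat, C_pow, C_eq_natCast]
      ring)
  simpa using h

/-- A polynomial satisfying the first order Chebyshev equation is an affine image of the
Chebyshev polynomial. -/
lemma eq_C_mul_chebT_add_C_of_first_order {f : ℂ[X]} {y₁ y₂ : ℂ} (hf : 0 < f.natDegree)
    (h : C ((f.natDegree : ℂ) ^ 2) * ((f - C y₁) * (f - C y₂)) =
      (X ^ 2 - 4) * f.derivative ^ 2) :
    ∃ a b : ℂ, a ≠ 0 ∧ f = C a * chebT f.natDegree + C b := by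
  have hode := chebyshev_equation_of_first_order (derivative_ne_zero_of_natDegree_pos hf) h
  have hT := chebT_equation hf
  obtain ⟨n, hn⟩ : ∃ n, n = f.natDegree := ⟨_, rfl⟩
  rw [← hn] at hode hT hf ⊢
  have hfl : f.coeff n ≠ 0 := by
    rw [hn]
    exact leadingCoeff_ne_zero.mpr (by rintro rfl; simp at hn; omega)
  have hTl : (chebT n).coeff n ≠ 0 := by
    have h0 : chebT n ≠ 0 := by
      intro h0
      have := natDegree_chebT n
      rw [h0, natDegree_zero] at this
      omega
    simpa [leadingCoeff, natDegree_chebT] using leadingCoeff_ne_zero.mpr h0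
  refine ⟨f.coeff n / (chebT n).coeff n, (y₁ + y₂) / 2, div_ne_zero hfl hTl, ?_⟩
  rw [← sub_eq_zero]
  apply eq_zero_of_chebyshev_equation (n := n)
  · rw [coeff_sub, coeff_add, coeff_C_mul, coeff_C, if_neg hf.ne', div_mul_cancel₀ _ hTl]
    ring
  · simp only [derivative_sub, derivative_add, derivative_mul, derivative_C]
    simp only [zero_mul, zero_add, add_zero, derivative_zero]
    linear_combination hode - C (f.coeff n / (chebT n).coeff n) * hT

/-- If all critical points of `f` are simple and the critical values are `y₁` and `y₂`, then `f`
satisfies a first order differential equation. -/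
lemma exists_first_order_equation {f : ℂ[X]} (hf : 1 < f.natDegree) {y₁ y₂ : ℂ}
    (hval : ∀ x, f.derivative.eval x = 0 → f.eval x = y₁ ∨ f.eval x = y₂)
    (hram : ∀ x, IsRamPt f x → ramIndex f x = 2) :
    ∃ s t : ℂ, C ((f.natDegree : ℂ) ^ 2) * ((f - C y₁) * (f - C y₂)) =
      ((X - C s) * (X - C t)) * f.derivative ^ 2 := by
  have hf0 : 0 < f.natDegree := by omega
  have hder := derivative_ne_zero_of_natDegree_pos hf0
  have hne : ∀ y, f - C y ≠ 0 := by
    intro y h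
    have := natDegree_sub_C (p := f) (a := y)
    rw [h, natDegree_zero] at this
    omega
  have hP : (f - C y₁) * (f - C y₂) ≠ 0 := mul_ne_zero (hne _) (hne _)
  have hdvd : f.derivative ^ 2 ∣ (f - C y₁) * (f - C y₂) := by
    rw [IsAlgClosed.dvd_iff_roots_le_roots (pow_ne_zero 2 hder) hP, Multiset.le_iff_count]
    intro x
    rw [roots_pow, Multiset.count_nsmul, count_roots, count_roots, rootMultiplicity_mul hP]
    by_cases hx : f.derivative.eval x = 0
    · have h2 := hram x ((isRamPt_iff_eval_derivative_eq_zero hf0 x).mpr hx)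
      have h1 := ramIndex_eq_rootMultiplicity_derivative_add_one hf0 x
      rw [ramIndex] at h1 h2
      rcases hval x hx with h | h <;> rw [h] at h1 h2 <;> omega
    · rw [rootMultiplicity_eq_zero hx]
      omega
  obtain ⟨q, hq⟩ := hdvd
  have hq0 : q ≠ 0 := by
    rintro rfl
    exact hP (by simpa using hq)
  have hqdeg : q.natDegree = 2 := by
    have h := congrArg natDegree hq
    rw [natDegree_mul (hne _) (hne _), natDegree_mul (pow_ne_zero 2 hder) hq0, natDegree_sub_C,
      natDegree_sub_C, natDegree_pow, natDegree_derivative] at h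
    omega
  obtain ⟨s, t, hst⟩ : ∃ s t, q.roots = {s, t} := by
    rw [← Multiset.card_eq_two, ← hqdeg]
    exact (IsAlgClosed.splits q).natDegree_eq_card_roots.symm
  have hqeq := (IsAlgClosed.splits q).eq_prod_roots
  have hlc : (f.natDegree : ℂ) ^ 2 * q.leadingCoeff = 1 := by
    have hfl : f.leadingCoeff ≠ 0 := leadingCoeff_ne_zero.mpr (by rintro rfl; simp at hf)
    have hl : ∀ y, (f - C y).leadingCoeff = f.leadingCoeff := fun y =>
      leadingCoeff_sub_of_degree_lt (degree_C_le.trans_lt (natDegree_pos_iff_degree_pos.mp hf0))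
    have h := congrArg leadingCoeff hq
    rw [leadingCoeff_mul, leadingCoeff_mul, leadingCoeff_pow, hl, hl, leadingCoeff_derivative] at h
    apply mul_right_cancel₀ (pow_ne_zero 2 hfl)
    linear_combination -h
  refine ⟨s, t, ?_⟩
  rw [hst] at hqeq
  simp only [Multiset.insert_eq_cons, Multiset.map_cons, Multiset.map_singleton,
    Multiset.prod_cons, Multiset.prod_singleton] at hqeq
  have hC : C ((f.natDegree : ℂ) ^ 2) * C q.leadingCoeff = 1 := by rw [← C_mul, hlc, C_1]
  rw [hq]
  conv_lhs => rw [hqeq]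
  linear_combination f.derivative ^ 2 * ((X - C s) * (X - C t)) * hC

/-- The points where the quadratic factor of the first order equation vanishes are critical
points of neither `f` nor of that factor. -/
lemma eval_derivative_mul_ne_zero_of_first_order {f q : ℂ[X]} (hf : 0 < f.natDegree) {y₁ y₂ : ℂ}
    (hy : y₁ ≠ y₂)
    (h : C ((f.natDegree : ℂ) ^ 2) * ((f - C y₁) * (f - C y₂)) = q * f.derivative ^ 2)
    {x : ℂ} (hx : q.eval x = 0) :
    (f.eval x = y₁ ∨ f.eval x = y₂) ∧ q.derivative.eval x * f.derivative.eval x ≠ 0 := by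
  have hn : (f.natDegree : ℂ) ≠ 0 := by exact_mod_cast hf.ne'
  have h1 := congrArg (eval x) h
  have h2 := congrArg (eval x)
    (second_order_of_first_order (derivative_ne_zero_of_natDegree_pos hf) h)
  simp [hx, hn, sub_eq_zero] at h1
  simp [hx] at h2
  refine ⟨h1, ?_⟩
  rw [← h2]
  apply mul_ne_zero (pow_ne_zero 2 hn)
  intro h0
  rcases h1 with h1 | h1 <;> rw [h1] at h0
  · exact hy (by linear_combination h0)
  · exact hy (by linear_combination -h0)

lemma ne_of_first_order {f : ℂ[X]} (hf : 0 < f.natDegree) {y₁ y₂ s t : ℂ} (hy : y₁ ≠ y₂)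
    (h : C ((f.natDegree : ℂ) ^ 2) * ((f - C y₁) * (f - C y₂)) =
      ((X - C s) * (X - C t)) * f.derivative ^ 2) : s ≠ t := by
  rintro rfl
  exact (eval_derivative_mul_ne_zero_of_first_order hf hy h (x := s) (by simp)).2 (by simp)

lemma dihedralPoly_of_branch_points {f : ℂ[X]} (hf : 1 < f.natDegree)
    (hb : {y : ℂ | IsBranchPt f y}.encard = 2) (hram : ∀ x, IsRamPt f x → ramIndex f x = 2) :
    DihedralPoly f := by
  have hf0 : 0 < f.natDegree := by omega
  obtain ⟨y₁, y₂, hy, hset⟩ := Set.encard_eq_two.mp hb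
  have hmem : ∀ y, IsBranchPt f y ↔ y = y₁ ∨ y = y₂ := fun y => by
    simpa using Set.ext_iff.mp hset y
  have hdeg : 2 < f.natDegree := by
    obtain ⟨x₁, hx₁, rfl⟩ := (hmem y₁).mpr (Or.inl rfl)
    obtain ⟨x₂, hx₂, rfl⟩ := (hmem y₂).mpr (Or.inr rfl)
    rw [isRamPt_iff_eval_derivative_eq_zero hf0] at hx₁ hx₂
    by_contra hle
    have h1 : f.derivative.natDegree = 1 := by
      rw [natDegree_derivative]
      omega
    obtain ⟨a, b, ha, hab⟩ := exists_coeffs_of_natDegree_eq_one h1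
    simp [hab] at hx₁ hx₂
    have : x₁ = x₂ := mul_left_cancel₀ ha (by linear_combination hx₁ - hx₂)
    exact hy (by rw [this])
  obtain ⟨s, t, hst⟩ := exists_first_order_equation hf (fun x hx => (hmem _).mp
    ⟨x, (isRamPt_iff_eval_derivative_eq_zero hf0 x).mpr hx, rfl⟩) hram
  have hne : s - t ≠ 0 := sub_ne_zero.mpr (ne_of_first_order hf0 hy hst)
  obtain ⟨m, hm⟩ : ∃ m : ℂ, m = (s - t) / 4 := ⟨_, rfl⟩
  obtain ⟨b, hb⟩ : ∃ b : ℂ, b = (s + t) / 2 := ⟨_, rfl⟩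
  have hm0 : m ≠ 0 := by
    rw [hm]
    exact div_ne_zero hne (by norm_num)
  have hs : C s = C b + 2 * C m := by
    rw [← C_ofNat, ← C_mul, ← C_add]
    congr 1
    rw [hm, hb]
    ring
  have ht : C t = C b - 2 * C m := by
    rw [← C_ofNat, ← C_mul, ← C_sub]
    congr 1
    rw [hm, hb]
    ring
  have hgdeg : (f.comp (C m * X + C b)).natDegree = f.natDegree := by
    rw [natDegree_comp, natDegree_linear hm0, mul_one]
  have hg := congrArg (fun p : ℂ[X] => p.comp (C m * X + C b)) hst
  obtain ⟨a, d, ha, hfe⟩ := eq_C_mul_chebT_add_C_of_first_order (f := f.comp (C m * X + C b))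
    (y₁ := y₁) (y₂ := y₂) (by rwa [hgdeg]) (by
      rw [hgdeg]
      simp only [mul_comp, sub_comp, C_comp, X_comp, pow_comp, hs, ht] at hg
      rw [hg, derivative_comp]
      simp
      ring)
  rw [hgdeg] at hfe
  refine ⟨f.natDegree, hdeg, C a * X + C d, C m⁻¹ * X + C (-b / m), natDegree_linear ha,
    natDegree_linear (inv_ne_zero hm0), ?_⟩
  have hinv : (C m * X + C b).comp (C m⁻¹ * X + C (-b / m)) = X := by
    simp only [add_comp, mul_comp, C_comp, X_comp, mul_add, ← mul_assoc, ← C_mul]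
    rw [mul_inv_cancel₀ hm0, mul_div_cancel₀ _ hm0]
    simp
  calc f = (f.comp (C m * X + C b)).comp (C m⁻¹ * X + C (-b / m)) := by
        rw [comp_assoc, hinv, comp_X]
    _ = _ := by
        rw [hfe]
        simp

lemma encard_special_points {f : ℂ[X]} (hf : 1 < f.natDegree)
    (hb : {y : ℂ | IsBranchPt f y}.encard = 2) (hram : ∀ x, IsRamPt f x → ramIndex f x = 2) :
    {x : ℂ | IsSpecialPt f x}.encard = 2 := by
  have hf0 : 0 < f.natDegree := by omega
  obtain ⟨y₁, y₂, hy, hset⟩ := Set.encard_eq_two.mp hb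
  have hmem : ∀ y, IsBranchPt f y ↔ y = y₁ ∨ y = y₂ := fun y => by
    simpa using Set.ext_iff.mp hset y
  obtain ⟨s, t, hst⟩ := exists_first_order_equation hf (fun x hx => (hmem _).mp
    ⟨x, (isRamPt_iff_eval_derivative_eq_zero hf0 x).mpr hx, rfl⟩) hram
  refine Set.encard_eq_two.mpr ⟨s, t, ne_of_first_order hf0 hy hst, ?_⟩
  ext x
  simp only [Set.mem_ofPred_eq, Set.mem_insert_iff, Set.mem_singleton_iff, IsSpecialPt,
    ramIndex_eq_one_iff hf0, hmem]
  constructor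
  · rintro ⟨hx, hval⟩
    have h := congrArg (eval x) hst
    have hP : (f.eval x - y₁) * (f.eval x - y₂) = 0 := by
      rcases hval with h | h <;> simp [h]
    simpa [hP, hx, sub_eq_zero] using h
  · intro hx
    have hq : ((X - C s) * (X - C t)).eval x = 0 := by
      rcases hx with rfl | rfl <;> simp
    obtain ⟨hval, hne⟩ := eval_derivative_mul_ne_zero_of_first_order hf0 hy hst hq
    exact ⟨right_ne_zero_of_mul hne, hval⟩

lemma branch_points_of_dihedralPoly {f : ℂ[X]} (h : DihedralPoly f) :
    {y : ℂ | IsBranchPt f y}.encard = 2 ∧ ∀ x, IsRamPt f x → ramIndex f x = 2 := by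
  obtain ⟨n, hn, l₁, l₂, h₁, h₂, hfe⟩ := h
  have hdeg : f.natDegree = n := by
    rw [hfe, natDegree_comp, natDegree_comp, h₁, h₂, natDegree_chebT]
    ring
  have hf0 : 0 < f.natDegree := by omega
  obtain ⟨a, b, ha, rfl⟩ := exists_coeffs_of_natDegree_eq_one h₁
  obtain ⟨c, d, hc, rfl⟩ := exists_coeffs_of_natDegree_eq_one h₂
  have hn0 : (n : ℂ) ≠ 0 := by exact_mod_cast (by omega : n ≠ 0)
  have hcrit : ∀ x, f.derivative.eval x = 0 ↔ (derivative (chebT n)).eval (c * x + d) = 0 := by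
    intro x
    rw [hfe]
    simp [derivative_comp, ha, hc]
  have hsq : ∀ z, (derivative (chebT n)).eval z = 0 →
      (chebT n).eval z = 2 ∨ (chebT n).eval z = -2 := by
    intro z hz
    have h := congrArg (eval z) (sq_mul_chebT_sq_sub_four n)
    simp [hz, hn0] at h
    exact sq_eq_sq_iff_eq_or_eq_neg.mp (by linear_combination h)
  have hval : ∀ x, IsRamPt f x → f.eval x = a * 2 + b ∨ f.eval x = a * (-2) + b := by
    intro x hx
    rw [isRamPt_iff_eval_derivative_eq_zero hf0, hcrit] at hx
    rw [hfe]
    rcases hsq _ hx with h | h <;> simp [h]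
  have hram : ∀ x, IsRamPt f x → ramIndex f x = 2 := by
    intro x hx
    rw [isRamPt_iff_eval_derivative_eq_zero hf0] at hx
    apply ramIndex_eq_two_of_eval_derivative hf0 hx
    rw [hcrit] at hx
    have h := congrArg (eval (c * x + d)) (chebT_equation (n := n) (by omega))
    simp [hx] at h
    have hT : (derivative (derivative (chebT n))).eval (c * x + d) ≠ 0 := by
      intro h0
      rcases hsq _ hx with h' | h' <;> simp [h0, h', hn0] at h
    rw [hfe]
    simp [derivative_comp, ha, hc, hT]
  refine ⟨?_, hram⟩
  have hnot : ∀ y, ∃ x, IsRamPt f x ∧ f.eval x ≠ y := by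
    intro y
    by_contra! hall
    obtain ⟨k, s, hk, hfs⟩ := eq_C_add_C_mul_X_sub_C_pow_of_critical_values (f := f) (y := y)
      (by omega) fun x hx => hall x ((isRamPt_iff_eval_derivative_eq_zero hf0 x).mpr hx)
    have hidx : ramIndex f s = f.natDegree := by
      have hev : f.eval s = y := by
        rw [hfs]
        simp [hf0.ne']
      rw [ramIndex, hev, sub_eq_iff_eq_add'.mpr hfs, rootMultiplicity_mul
        (mul_ne_zero (C_ne_zero.mpr hk) (pow_ne_zero _ (X_sub_C_ne_zero s))),
        rootMultiplicity_C, rootMultiplicity_X_sub_C_pow, zero_add]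
    have := hram s (by rw [IsRamPt, hidx]; omega)
    omega
  refine Set.encard_eq_two.mpr ⟨a * 2 + b, a * (-2) + b, ?_, ?_⟩
  · intro h
    exact ha (by linear_combination h / 4)
  · ext y
    simp only [Set.mem_ofPred_eq, Set.mem_insert_iff, Set.mem_singleton_iff]
    constructor
    · rintro ⟨x, hx, rfl⟩
      exact hval x hx
    · rintro (rfl | rfl)
      · obtain ⟨x, hx, hne⟩ := hnot (a * (-2) + b)
        exact ⟨x, hx, (hval x hx).resolve_right hne⟩
      · obtain ⟨x, hx, hne⟩ := hnot (a * 2 + b)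
        exact ⟨x, hx, (hval x hx).resolve_left hne⟩

theorem ramification_characterization
    (f : ℂ[X]) (hf : 1 < f.natDegree) :
    (CyclicPoly f ↔ ∃! y : ℂ, IsBranchPt f y) ∧
    ((∃! y : ℂ, IsBranchPt f y) ↔ ∃! x : ℂ, IsRamPt f x) ∧
    (DihedralPoly f ↔
      ({y : ℂ | IsBranchPt f y}.encard = 2 ∧ ∀ x : ℂ, IsRamPt f x → ramIndex f x = 2)) ∧
    (({y : ℂ | IsBranchPt f y}.encard = 2 ∧ ∀ x : ℂ, IsRamPt f x → ramIndex f x = 2) →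
      {x : ℂ | IsSpecialPt f x}.encard = 2) :=
  ⟨⟨fun h => existsUnique_isBranchPt_of_existsUnique_isRamPt
      (existsUnique_isRamPt_of_cyclicPoly hf h), cyclicPoly_of_existsUnique_isBranchPt hf⟩,
    ⟨fun h => existsUnique_isRamPt_of_cyclicPoly hf (cyclicPoly_of_existsUnique_isBranchPt hf h),
      existsUnique_isBranchPt_of_existsUnique_isRamPt⟩,
    ⟨branch_points_of_dihedralPoly, fun h => dihedralPoly_of_branch_points hf h.1 h.2⟩,
    fun h => encard_special_points hf h.1 h.2⟩
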